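/- arXiv:1901.10371 — 3 statements merged into one kernel-verified Lean document; each statement's English description precedes it below -/
import Mathlib

section
/- (Robustness monotonicity under ℓ₁ contraction.) Let V be a linear subspace of ℝⁿ, Q the orthogonal projection onto V, and suppose the random input x lies in V almost surely. If w ∈ ℝⁿ satisfies ‖Q w‖₁ ≤ ‖w‖₁, then for every ε ≥ 0 the adversarial error of the projected classifier is at most that of the original one: p_ε(Q w) ≤ p_ε(w). -/
open MeasureTheory RealInnerProductSpace

/-- Robustness monotonicity under ℓ₁ contraction: if the random input lies a.s. in the
subspace `V`, `Q` is the orthogonal projection onto `V`, and `‖Q w‖₁ ≤ ‖w‖₁`, then the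
adversarial error `p_ε(v) = P(y·⟪v, x⟫ < ε·‖v‖₁)` satisfies `p_ε(Q w) ≤ p_ε(w)`. -/
theorem adversarial_error_mono_of_l1_contraction (n : ℕ)
    {Ω : Type*} [MeasurableSpace Ω] (P : Measure Ω) [IsProbabilityMeasure P]
    (x : Ω → EuclideanSpace ℝ (Fin n)) (y : Ω → ℝ)
    (hx : Measurable x) (hy : Measurable y)
    (hylabel : ∀ᵐ ω ∂P, y ω = 1 ∨ y ω = -1)
    (V : Submodule ℝ (EuclideanSpace ℝ (Fin n)))
    (Q : EuclideanSpace ℝ (Fin n) →ₗ[ℝ] EuclideanSpace ℝ (Fin n))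
    (hQidem : ∀ v, Q (Q v) = Q v)
    (hQselfadj : ∀ u v, ⟪Q u, v⟫ = ⟪u, Q v⟫)
    (hQrange : LinearMap.range Q = V)
    (hxV : ∀ᵐ ω ∂P, x ω ∈ V)
    (w : EuclideanSpace ℝ (Fin n))
    (hl1 : ∑ i, |Q w i| ≤ ∑ i, |w i|)
    (ε : ℝ) (hε : 0 ≤ ε) :
    P {ω | y ω * ⟪Q w, x ω⟫ < ε * ∑ i, |Q w i|} ≤
      P {ω | y ω * ⟪w, x ω⟫ < ε * ∑ i, |w i|} := by
  apply measure_mono_ae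
  filter_upwards [hxV] with ω hω h
  rw [← hQrange] at hω
  obtain ⟨v, hv⟩ := hω
  have hQx : Q (x ω) = x ω := by rw [← hv, hQidem]
  have h' : y ω * ⟪Q w, x ω⟫ < ε * ∑ i, |Q w i| := h
  rw [hQselfadj, hQx] at h'
  exact lt_of_lt_of_le h' (mul_le_mul_of_nonneg_left hl1 hε)
end

section
/- (Theorem 1, part 2: projection onto the data subspace improves adversarial robustness.) Let V be a linear subspace of ℝⁿ, Q the orthogonal projection onto V, and suppose the random input x lies in V almost surely. Let w ∈ ℝⁿ be a weight vector with Q w ≠ 0 whose effective sparsity satisfies s̄(Q w) ≤ s̄(w). Then for every ε ≥ 0 the adversarial error against ℓ∞-attacks of budget ε is either improved or unchanged by the projection: p_ε(Q w) ≤ p_ε(w). -/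
open MeasureTheory RealInnerProductSpace

/-- Theorem 1, part 2: projection onto the data subspace improves adversarial robustness.
If the random input lies a.s. in the subspace `V`, `Q` is the orthogonal projection onto
`V`, `Q w ≠ 0`, and the effective sparsity `s̄(v) = ‖v‖₁ / ‖v‖₂` satisfies
`s̄(Q w) ≤ s̄(w)`, then the adversarial error `p_ε(v) = P(y·⟪v, x⟫ < ε·‖v‖₁)` against
ℓ∞-attacks of budget `ε` satisfies `p_ε(Q w) ≤ p_ε(w)`. -/
theorem adversarial_error_improved_by_projection (n : ℕ)
    {Ω : Type*} [MeasurableSpace Ω] (P : Measure Ω) [IsProbabilityMeasure P]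
    (x : Ω → EuclideanSpace ℝ (Fin n)) (y : Ω → ℝ)
    (hx : Measurable x) (hy : Measurable y)
    (hylabel : ∀ᵐ ω ∂P, y ω = 1 ∨ y ω = -1)
    (V : Submodule ℝ (EuclideanSpace ℝ (Fin n)))
    (Q : EuclideanSpace ℝ (Fin n) →ₗ[ℝ] EuclideanSpace ℝ (Fin n))
    (hQidem : ∀ v, Q (Q v) = Q v)
    (hQselfadj : ∀ u v, ⟪Q u, v⟫ = ⟪u, Q v⟫)
    (hQrange : LinearMap.range Q = V)
    (hxV : ∀ᵐ ω ∂P, x ω ∈ V)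
    (w : EuclideanSpace ℝ (Fin n)) (hQw : Q w ≠ 0)
    (hsparse : (∑ i, |Q w i|) / ‖Q w‖ ≤ (∑ i, |w i|) / ‖w‖)
    (ε : ℝ) (hε : 0 ≤ ε) :
    P {ω | y ω * ⟪Q w, x ω⟫ < ε * ∑ i, |Q w i|} ≤
      P {ω | y ω * ⟪w, x ω⟫ < ε * ∑ i, |w i|} := by
  have hq : 0 < ‖Q w‖ := norm_pos_iff.mpr hQw
  have hle : ‖Q w‖ ≤ ‖w‖ := by
    have h1 : ‖Q w‖ * ‖Q w‖ ≤ ‖w‖ * ‖Q w‖ := by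
      calc ‖Q w‖ * ‖Q w‖ = ⟪Q w, Q w⟫ := (real_inner_self_eq_norm_mul_norm _).symm
        _ = ⟪w, Q w⟫ := by rw [hQselfadj, hQidem]
        _ ≤ ‖w‖ * ‖Q w‖ := real_inner_le_norm _ _
    exact le_of_mul_le_mul_right h1 hq
  have hp : 0 < ‖w‖ := hq.trans_le hle
  have hb : 0 ≤ ∑ i, |w i| := Finset.sum_nonneg fun i _ => abs_nonneg _
  have hl1 : ∑ i, |Q w i| ≤ ∑ i, |w i| := by
    rw [div_le_div_iff₀ hq hp] at hsparse
    have h2 : (∑ i, |Q w i|) * ‖w‖ ≤ (∑ i, |w i|) * ‖w‖ :=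
      hsparse.trans (mul_le_mul_of_nonneg_left hle hb)
    exact le_of_mul_le_mul_right h2 hp
  apply measure_mono_ae
  filter_upwards [hxV] with ω hω h
  rw [← hQrange] at hω
  obtain ⟨u, hu⟩ := hω
  have hin : ⟪Q w, x ω⟫ = ⟪w, x ω⟫ := by
    rw [hQselfadj, ← hu, hQidem]
  have h' : y ω * ⟪Q w, x ω⟫ < ε * ∑ i, |Q w i| := h
  rw [hin] at h'
  exact h'.trans_le (mul_le_mul_of_nonneg_left hl1 hε)
end

section
/- (Theorem 1 combined.) Let V be a linear subspace of ℝⁿ, Q the orthogonal projection onto V, and suppose the random input x lies in V almost surely. Let w ∈ ℝⁿ with Q w ≠ 0 and s̄(Q w) ≤ s̄(w). Then simultaneously: (i) the accuracy is unchanged, p₀(Q w) = p₀(w), and (ii) for every ε ≥ 0 the adversarial robustness against ℓ∞-attacks is improved or unchanged, p_ε(Q w) ≤ p_ε(w). -/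
open MeasureTheory RealInnerProductSpace

/-- Theorem 1 combined: if the random input lies a.s. in the subspace `V`, `Q` is the
orthogonal projection onto `V`, `Q w ≠ 0`, and the effective sparsity
`s̄(v) = ‖v‖₁ / ‖v‖₂` satisfies `s̄(Q w) ≤ s̄(w)`, then (i) the accuracy is unchanged,
`p₀(Q w) = p₀(w)`, and (ii) for every `ε ≥ 0` the adversarial error
`p_ε(v) = P(y·⟪v, x⟫ < ε·‖v‖₁)` satisfies `p_ε(Q w) ≤ p_ε(w)`. -/
theorem projection_preserves_accuracy_and_improves_robustness (n : ℕ)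
    {Ω : Type*} [MeasurableSpace Ω] (P : Measure Ω) [IsProbabilityMeasure P]
    (x : Ω → EuclideanSpace ℝ (Fin n)) (y : Ω → ℝ)
    (hx : Measurable x) (hy : Measurable y)
    (hylabel : ∀ᵐ ω ∂P, y ω = 1 ∨ y ω = -1)
    (V : Submodule ℝ (EuclideanSpace ℝ (Fin n)))
    (Q : EuclideanSpace ℝ (Fin n) →ₗ[ℝ] EuclideanSpace ℝ (Fin n))
    (hQidem : ∀ v, Q (Q v) = Q v)
    (hQselfadj : ∀ u v, ⟪Q u, v⟫ = ⟪u, Q v⟫)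
    (hQrange : LinearMap.range Q = V)
    (hxV : ∀ᵐ ω ∂P, x ω ∈ V)
    (w : EuclideanSpace ℝ (Fin n)) (hQw : Q w ≠ 0)
    (hsparse : (∑ i, |Q w i|) / ‖Q w‖ ≤ (∑ i, |w i|) / ‖w‖) :
    P {ω | y ω * ⟪Q w, x ω⟫ < 0} = P {ω | y ω * ⟪w, x ω⟫ < 0} ∧
      ∀ ε : ℝ, 0 ≤ ε →
        P {ω | y ω * ⟪Q w, x ω⟫ < ε * ∑ i, |Q w i|} ≤
          P {ω | y ω * ⟪w, x ω⟫ < ε * ∑ i, |w i|} := by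
  have hinner : ∀ᵐ ω ∂P, ⟪Q w, x ω⟫ = ⟪w, x ω⟫ := by
    filter_upwards [hxV] with ω hω
    rw [← hQrange] at hω
    obtain ⟨u, hu⟩ := hω
    rw [hQselfadj, ← hu, hQidem]
  have hpos : 0 < ‖Q w‖ := norm_pos_iff.mpr hQw
  have hle : ‖Q w‖ ≤ ‖w‖ := by
    have h1 : ‖Q w‖ * ‖Q w‖ ≤ ‖w‖ * ‖Q w‖ := by
      rw [← real_inner_self_eq_norm_mul_norm, hQselfadj, hQidem]
      exact real_inner_le_norm _ _
    exact le_of_mul_le_mul_right h1 hpos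
  have hwpos : 0 < ‖w‖ := hpos.trans_le hle
  have hl1 : ∑ i, |Q w i| ≤ ∑ i, |w i| := by
    have hnn : 0 ≤ ∑ i, |w i| := Finset.sum_nonneg fun i _ => abs_nonneg _
    rw [div_le_div_iff₀ hpos hwpos] at hsparse
    exact le_of_mul_le_mul_right
      (hsparse.trans (mul_le_mul_of_nonneg_left hle hnn)) hwpos
  refine ⟨?_, fun ε hε => ?_⟩
  · apply measure_congr
    filter_upwards [hinner] with ω hω
    apply propext
    change y ω * ⟪Q w, x ω⟫ < 0 ↔ y ω * ⟪w, x ω⟫ < 0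
    rw [hω]
  · apply measure_mono_ae
    filter_upwards [hinner] with ω hω
    intro h
    change y ω * ⟪Q w, x ω⟫ < ε * ∑ i, |Q w i| at h
    change y ω * ⟪w, x ω⟫ < ε * ∑ i, |w i|
    rw [hω] at h
    exact h.trans_le (mul_le_mul_of_nonneg_left hl1 hε)
end
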